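/- arXiv:1310.4005 — 2 statements merged into one kernel-verified Lean document; each statement's English description precedes it below -/
import Mathlib

section
/- Let a : ℝ_{≥0} → (ℕ → ℝ) be a family of sequences with a_0(t) = 1 for all t ≥ 0 and satisfying the binomial semigroup property a_k(t+v) = Σ_{j=0}^k binom(k,j) a_j(t) a_{k−j}(v) for all t, v ≥ 0 and k ≥ 0. For each t define q_0(t) = 1, q_j(t) = −Σ_{i=0}^{j−1} binom(j,i) q_i(t) a_{j−i}(t) for j ≥ 1, and Q_k(x,t) := Σ_{j=0}^k binom(k,j) q_j(t) x^{k−j}; set P_j(v) := Q_j(0,v). Then for all t, v ≥ 0, k ≥ 0 and x ∈ ℝ, the Sheffer identity holds: Q_k(x, t+v) = Σ_{j=0}^k binom(k,j) P_j(v) Q_{k−j}(x, t). -/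
open scoped BigOperators NNReal

/-- The exponential generating function of a real sequence. -/
noncomputable def expGenFun (f : ℕ → ℝ) : PowerSeries ℝ :=
  PowerSeries.mk fun n => f n / (n.factorial : ℝ)

theorem expGenFun_injective : Function.Injective expGenFun := by
  intro f g h
  funext n
  have hn := congrArg (PowerSeries.coeff n) h
  simp only [expGenFun, PowerSeries.coeff_mk] at hn
  exact (div_left_inj' (by exact_mod_cast n.factorial_ne_zero)).mp hn

theorem expGenFun_mul (f g : ℕ → ℝ) :
    expGenFun f * expGenFun g =
      expGenFun fun n => ∑ j ∈ Finset.range (n + 1), (n.choose j : ℝ) * f j * g (n - j) := by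
  ext n
  simp only [expGenFun, PowerSeries.coeff_mul, PowerSeries.coeff_mk]
  rw [Finset.Nat.sum_antidiagonal_eq_sum_range_succ
    (fun i j => f i / (i.factorial : ℝ) * (g j / (j.factorial : ℝ))), Finset.sum_div]
  refine Finset.sum_congr rfl fun j hj => ?_
  rw [Nat.cast_choose ℝ (Finset.mem_range_succ_iff.mp hj)]
  have hn : (n.factorial : ℝ) ≠ 0 := by exact_mod_cast n.factorial_ne_zero
  field_simp

/-- A sequence defined by the recursion for the inverse binomial convolution of `a` has the inverse
exponential generating function. -/
theorem expGenFun_mul_eq_one {a q : ℕ → ℝ} (ha0 : a 0 = 1) (hq0 : q 0 = 1)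
    (hq : ∀ j : ℕ, 1 ≤ j →
      q j = -∑ i ∈ Finset.range j, (j.choose i : ℝ) * q i * a (j - i)) :
    expGenFun q * expGenFun a = 1 := by
  rw [expGenFun_mul]
  ext n
  rw [expGenFun, PowerSeries.coeff_mk, PowerSeries.coeff_one]
  rcases Nat.eq_zero_or_pos n with rfl | hn
  · simp [ha0, hq0]
  · rw [Finset.sum_range_succ, hq n hn, if_neg hn.ne']
    simp [ha0]

/-- **Sheffer identity for time-space harmonic polynomials.** If the moment family
`a : ℝ≥0 → ℕ → ℝ` satisfies `a_0(t) = 1` and the binomial semigroup property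
`a_k(t+v) = ∑_j C(k,j) a_j(t) a_{k-j}(v)`, and `Q_k(x,t) = ∑_j C(k,j) q_j(t) x^{k-j}` with
`q(t)` the inverse binomial convolution of `a(t)`, then with `P_j(v) = Q_j(0,v)` one has
`Q_k(x, t+v) = ∑_{j=0}^k C(k,j) P_j(v) Q_{k-j}(x, t)`. -/
theorem sheffer_identity (a : ℝ≥0 → ℕ → ℝ)
    (ha0 : ∀ t : ℝ≥0, a t 0 = 1)
    (hsemi : ∀ (t v : ℝ≥0) (k : ℕ),
      a (t + v) k = ∑ j ∈ Finset.range (k + 1), (k.choose j : ℝ) * a t j * a v (k - j))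
    (q : ℝ≥0 → ℕ → ℝ) (hq0 : ∀ t : ℝ≥0, q t 0 = 1)
    (hq : ∀ (t : ℝ≥0) (j : ℕ), 1 ≤ j →
      q t j = -∑ i ∈ Finset.range j, (j.choose i : ℝ) * q t i * a t (j - i))
    (Q : ℕ → ℝ → ℝ≥0 → ℝ)
    (hQ : ∀ (k : ℕ) (x : ℝ) (t : ℝ≥0),
      Q k x t = ∑ j ∈ Finset.range (k + 1), (k.choose j : ℝ) * q t j * x ^ (k - j))
    (P : ℕ → ℝ≥0 → ℝ) (hP : ∀ (j : ℕ) (v : ℝ≥0), P j v = Q j 0 v) :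
    ∀ (t v : ℝ≥0) (k : ℕ) (x : ℝ),
      Q k x (t + v) = ∑ j ∈ Finset.range (k + 1), (k.choose j : ℝ) * P j v * Q (k - j) x t := by
  intro t v k x
  have hPq : P = fun j v => q v j := by
    funext j v
    rw [hP, hQ, Finset.sum_range_succ, Finset.sum_eq_zero]
    · simp
    · intro i hi
      rw [zero_pow (Nat.sub_ne_zero_of_lt (Finset.mem_range.mp hi)), mul_zero]
  have hinv (s : ℝ≥0) : expGenFun (q s) * expGenFun (a s) = 1 :=
    expGenFun_mul_eq_one (ha0 s) (hq0 s) (hq s)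
  have hadd : expGenFun (a (t + v)) = expGenFun (a t) * expGenFun (a v) := by
    rw [expGenFun_mul, ← funext (hsemi t v)]
  have hqadd : expGenFun (q (t + v)) = expGenFun (q v) * expGenFun (q t) := by
    have h := hinv (t + v)
    rw [hadd] at h
    linear_combination (expGenFun (q v) * expGenFun (q t)) * h -
      expGenFun (q (t + v)) * expGenFun (q v) * expGenFun (a v) * hinv t -
      expGenFun (q (t + v)) * hinv v
  have hQgen (s : ℝ≥0) :
      expGenFun (fun n => Q n x s) = expGenFun (q s) * expGenFun (fun n => x ^ n) := by
    rw [expGenFun_mul, ← funext fun n => hQ n x s]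
  have key : expGenFun (fun n => Q n x (t + v)) =
      expGenFun (q v) * expGenFun (fun n => Q n x t) := by
    rw [hQgen, hQgen, hqadd, mul_assoc]
  rw [expGenFun_mul] at key
  rw [hPq]
  exact congrFun (expGenFun_injective key) k
end

section
/- For μ ∈ ℝ define the actuarial polynomial g_k(x, μ) := Σ_{j=0}^k binom(k,j) μ^{k−j} w_j(x), where w_j(x) := Σ_{i=0}^j S(j,i)(−x)^i and S(j,i) are the Stirling numbers of the second kind. Let λ > 0 and 0 ≤ v < t. Then for every k ≥ 0 and x ∈ ℝ: ∫_0^∞ g_k(x + g, λt) · (g^{λ(t−v)−1} e^{−g}/Γ(λ(t−v))) dg = g_k(x, λv). -/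
open MeasureTheory
open scoped BigOperators

/-- The Stirling numbers of the second kind `S(n, l)`. -/
def stirling2 : ℕ → ℕ → ℕ
  | 0, 0 => 1
  | 0, _ + 1 => 0
  | _ + 1, 0 => 0
  | n + 1, l + 1 => (l + 1) * stirling2 n (l + 1) + stirling2 n l

/-- `w_j(x) = ∑_{i=0}^j S(j,i) (-x)^i`. -/
noncomputable def wActuarial (j : ℕ) (x : ℝ) : ℝ :=
  ∑ i ∈ Finset.range (j + 1), (stirling2 j i : ℝ) * (-x) ^ i

/-- The actuarial polynomial `g_k(x, μ) = ∑_{j=0}^k C(k,j) μ^{k-j} w_j(x)`. -/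
noncomputable def actuarial (k : ℕ) (x μ : ℝ) : ℝ :=
  ∑ j ∈ Finset.range (k + 1), (k.choose j : ℝ) * μ ^ (k - j) * wActuarial j x

open Polynomial

/-- The operator `p ↦ X (p' - p)`, which raises `w_j` to `w_{j+1}`. -/
noncomputable def actuarialRaising : Module.End ℝ ℝ[X] :=
  LinearMap.mulLeft ℝ X ∘ₗ (derivative - LinearMap.id)

theorem actuarialRaising_apply (p : ℝ[X]) :
    actuarialRaising p = X * (derivative p - p) := rfl

/-- The polynomial `g_k(·, μ)`, obtained by iterating the raising operator shifted by `μ`. -/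
noncomputable def actuarialPoly (k : ℕ) (μ : ℝ) : ℝ[X] :=
  ((actuarialRaising + algebraMap ℝ (Module.End ℝ ℝ[X]) μ) ^ k) 1

theorem actuarialPoly_zero (μ : ℝ) : actuarialPoly 0 μ = 1 := rfl

theorem actuarialPoly_succ (k : ℕ) (μ : ℝ) :
    actuarialPoly (k + 1) μ =
      X * (derivative (actuarialPoly k μ) - actuarialPoly k μ) + μ • actuarialPoly k μ := by
  rw [actuarialPoly, pow_succ']
  rfl

theorem stirling2_eq_zero_of_lt : ∀ {n l : ℕ}, n < l → stirling2 n l = 0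
  | 0, _ + 1, _ => rfl
  | n + 1, l + 1, h => by
    rw [stirling2, stirling2_eq_zero_of_lt (by omega : n < l + 1),
      stirling2_eq_zero_of_lt (by omega : n < l), mul_zero]

theorem coeff_actuarialRaising_pow (j i : ℕ) :
    ((actuarialRaising ^ j) 1).coeff i = (stirling2 j i : ℝ) * (-1) ^ i := by
  induction j generalizing i with
  | zero => cases i <;> simp [stirling2, coeff_one]
  | succ j ih =>
    rw [pow_succ', Module.End.mul_apply, actuarialRaising_apply]
    cases i with
    | zero => simp [stirling2]
    | succ i =>
      rw [coeff_X_mul, coeff_sub, coeff_derivative, ih, ih, stirling2]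
      push_cast
      ring

theorem eval_actuarialRaising_pow (j : ℕ) (x : ℝ) :
    ((actuarialRaising ^ j) 1).eval x = wActuarial j x := by
  have hdeg : ((actuarialRaising ^ j) 1).natDegree < j + 1 := by
    refine Nat.lt_succ_of_le (natDegree_le_iff_coeff_eq_zero.2 fun i hi => ?_)
    rw [coeff_actuarialRaising_pow, stirling2_eq_zero_of_lt hi, Nat.cast_zero, zero_mul]
  rw [eval_eq_sum_range' hdeg, wActuarial]
  refine Finset.sum_congr rfl fun i _ => ?_
  rw [coeff_actuarialRaising_pow, neg_pow x, mul_assoc]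

theorem eval_actuarialPoly (k : ℕ) (x μ : ℝ) :
    (actuarialPoly k μ).eval x = actuarial k x μ := by
  rw [actuarialPoly, (Algebra.commute_algebraMap_right μ actuarialRaising).add_pow, LinearMap.sum_apply,
    eval_finsetSum, actuarial]
  refine Finset.sum_congr rfl fun j _ => ?_
  rw [← map_pow, ← map_natCast (algebraMap ℝ (Module.End ℝ ℝ[X])), mul_assoc, ← map_mul,
    Module.End.mul_apply, Module.algebraMap_end_apply, map_smul, eval_smul,
    eval_actuarialRaising_pow, smul_eq_mul]
  ring

theorem hasDerivAt_linearMap_taylor (L : ℝ[X] →ₗ[ℝ] ℝ) (p : ℝ[X]) (x : ℝ) :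
    HasDerivAt (fun y => L (taylor y p)) (L (taylor x (derivative p))) x := by
  have key (q : ℝ[X]) (hq : q.natDegree ≤ p.natDegree) (y : ℝ) :
      L (taylor y q) =
        ∑ n ∈ Finset.range (p.natDegree + 1), (hasseDeriv n q).eval y * L (X ^ n) := by
    have hdeg : (taylor y q).natDegree < p.natDegree + 1 := by
      rw [natDegree_taylor]
      omega
    conv_lhs => rw [as_sum_range' _ _ hdeg, map_sum]
    refine Finset.sum_congr rfl fun n _ => ?_
    rw [taylor_coeff, ← smul_X_eq_monomial, map_smul, smul_eq_mul]
  have hcomm (n : ℕ) : hasseDeriv n (derivative p) = derivative (hasseDeriv n p) := by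
    rw [← hasseDeriv_one, ← LinearMap.comp_apply, ← LinearMap.comp_apply, hasseDeriv_comp,
      hasseDeriv_comp, add_comm 1 n, Nat.choose_symm_add]
  rw [funext (key p le_rfl), key _ ((natDegree_derivative_le p).trans (Nat.sub_le _ _))]
  refine HasDerivAt.fun_sum fun n _ => ?_
  rw [hcomm]
  exact ((hasseDeriv n p).hasDerivAt x).mul_const _

/-- A normalized linear functional satisfying the integration by parts rule of the Gamma
distribution with shape `a` averages `g_k(x + ·, m + a)` to `g_k(x, m)`. -/
theorem linearMap_taylor_actuarialPoly (L : ℝ[X] →ₗ[ℝ] ℝ) (a m : ℝ) (h_one : L 1 = 1)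
    (h_parts : ∀ p, L (X * p) = a * L p + L (X * derivative p)) (k : ℕ) (x : ℝ) :
    L (taylor x (actuarialPoly k (m + a))) = (actuarialPoly k m).eval x := by
  induction k generalizing x with
  | zero => simp [actuarialPoly_zero, h_one]
  | succ k ih =>
    have hderiv : L (taylor x (derivative (actuarialPoly k (m + a)))) =
        (derivative (actuarialPoly k m)).eval x := by
      have h := hasDerivAt_linearMap_taylor L (actuarialPoly k (m + a)) x
      rw [funext ih] at h
      exact h.unique ((actuarialPoly k m).hasDerivAt x)
    have hcomm : taylor x (derivative (actuarialPoly k (m + a))) =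
        derivative (taylor x (actuarialPoly k (m + a))) := by
      simp [taylor_apply, derivative_comp]
    have hparts := h_parts (taylor x (actuarialPoly k (m + a)))
    rw [← hcomm] at hparts
    rw [actuarialPoly_succ, actuarialPoly_succ, map_add, map_smul, taylor_mul, taylor_X, map_sub,
      add_mul, mul_sub X, ← smul_eq_C_mul]
    simp only [map_add, map_sub, map_smul, smul_eq_mul, eval_add, eval_sub, eval_mul, eval_X,
      eval_smul]
    rw [hparts, hderiv, ih]
    ring

theorem eval_X_pow_mul_gammaDensity (a : ℝ) (n : ℕ) {g : ℝ} (hg : g ∈ Set.Ioi (0 : ℝ)) :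
    ((X : ℝ[X]) ^ n).eval g * (g ^ (a - 1) * Real.exp (-g) / Real.Gamma a) =
      Real.exp (-g) * g ^ (a + n - 1) / Real.Gamma a := by
  rw [add_sub_right_comm, Real.rpow_add_natCast (ne_of_gt hg), eval_pow, eval_X]
  ring

theorem integrableOn_eval_mul_gammaDensity {a : ℝ} (ha : 0 < a) (p : ℝ[X]) :
    IntegrableOn (fun g => p.eval g * (g ^ (a - 1) * Real.exp (-g) / Real.Gamma a))
      (Set.Ioi 0) := by
  induction p using Polynomial.induction_on' with
  | add p q hp hq =>
    simp only [eval_add, add_mul]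
    exact hp.add hq
  | monomial n c =>
    refine IntegrableOn.congr_fun (((Real.GammaIntegral_convergent
      (by positivity : 0 < a + n)).div_const (Real.Gamma a)).const_mul c) (fun g hg => ?_)
      measurableSet_Ioi
    rw [← smul_X_eq_monomial, eval_smul, smul_eq_mul, mul_assoc,
      eval_X_pow_mul_gammaDensity a n hg]

/-- Expectation of a polynomial under the Gamma distribution with shape `a` and rate `1`. -/
noncomputable def gammaExpectation {a : ℝ} (ha : 0 < a) : ℝ[X] →ₗ[ℝ] ℝ where
  toFun p := ∫ g in Set.Ioi (0 : ℝ), p.eval g * (g ^ (a - 1) * Real.exp (-g) / Real.Gamma a)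
  map_add' p q := by
    simp only [eval_add, add_mul]
    exact integral_add (integrableOn_eval_mul_gammaDensity ha p)
      (integrableOn_eval_mul_gammaDensity ha q)
  map_smul' c p := by
    simp only [eval_smul, smul_eq_mul, mul_assoc, integral_const_mul, RingHom.id_apply]

theorem gammaExpectation_X_pow {a : ℝ} (ha : 0 < a) (n : ℕ) :
    gammaExpectation ha (X ^ n) = Real.Gamma (a + n) / Real.Gamma a := by
  rw [Real.Gamma_eq_integral (by positivity : 0 < a + n), ← integral_div]
  exact setIntegral_congr_fun measurableSet_Ioi fun g hg => eval_X_pow_mul_gammaDensity a n hg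

theorem gammaExpectation_one {a : ℝ} (ha : 0 < a) : gammaExpectation ha 1 = 1 := by
  simpa [div_self (Real.Gamma_pos_of_pos ha).ne'] using gammaExpectation_X_pow ha 0

theorem gammaExpectation_X_mul {a : ℝ} (ha : 0 < a) (p : ℝ[X]) :
    gammaExpectation ha (X * p) =
      a * gammaExpectation ha p + gammaExpectation ha (X * derivative p) := by
  induction p using Polynomial.induction_on' with
  | add p q hp hq =>
    simp only [mul_add, map_add, hp, hq]
    ring
  | monomial n c =>
    have hX : X * derivative ((X : ℝ[X]) ^ n) = (n : ℝ) • X ^ n := by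
      cases n with
      | zero => simp
      | succ n =>
        rw [derivative_X_pow, smul_eq_C_mul, Nat.add_sub_cancel]
        ring
    have hpos : a + n ≠ 0 := by positivity
    rw [← smul_X_eq_monomial, derivative_smul, mul_smul_comm, mul_smul_comm, hX, ← pow_succ']
    simp only [map_smul, smul_eq_mul, gammaExpectation_X_pow]
    rw [Nat.cast_succ, ← add_assoc, Real.Gamma_add_one hpos]
    ring

/-- **Time-space harmonicity of the actuarial polynomials with respect to the Gamma process
`G_t(λ,1)`**: for `λ > 0` and `0 ≤ v < t`, averaging `g_k(x + ·, λt)` against the Gamma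
distribution with shape `λ(t - v)` and rate `1` yields `g_k(x, λv)`. -/
theorem actuarial_tsh (lam : ℝ) (hlam : 0 < lam) (v t : ℝ) (hv : 0 ≤ v) (hvt : v < t) :
    ∀ (k : ℕ) (x : ℝ),
      ∫ g in Set.Ioi (0 : ℝ),
          actuarial k (x + g) (lam * t) *
            (g ^ (lam * (t - v) - 1) * Real.exp (-g) / Real.Gamma (lam * (t - v)))
        = actuarial k x (lam * v) := by
  intro k x
  have ha : 0 < lam * (t - v) := mul_pos hlam (sub_pos.2 hvt)
  have h := linearMap_taylor_actuarialPoly (gammaExpectation ha) _ (lam * v)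
    (gammaExpectation_one ha) (gammaExpectation_X_mul ha) k x
  rw [show lam * v + lam * (t - v) = lam * t by ring, eval_actuarialPoly] at h
  rw [← h]
  simp only [gammaExpectation, LinearMap.coe_mk, AddHom.coe_mk, taylor_eval, eval_actuarialPoly,
    add_comm x]
end
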